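/- arXiv:2106.13646 — 4 statements merged into one kernel-verified Lean document; each statement's English description precedes it below -/
import Mathlib

section
/- Let m be a positive integer and n = m². A board f : Fin n × Fin n → Fin n is a Sudoku solution if and only if the following three conditions hold: (i) every value v ∈ Fin n appears exactly once in each block; (ii) whenever two cells lying in different blocks of the same band carry the same value under f, they lie in different rows; (iii) whenever two cells lying in different blocks of the same stack carry the same value under f, they lie in different columns. -/
/-- For `n = m²`, a board `f : Fin n × Fin n → Fin n` is a Sudoku solution
(every value appears exactly once in each row, column, and block) if and only if
(i) every value appears exactly once in each block;
(ii) cells in different blocks of the same band with equal values lie in different rows;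
(iii) cells in different blocks of the same stack with equal values lie in different columns. -/
theorem sudoku_iff_block_band_stack (m : ℕ) (hm : 0 < m)
    (f : Fin (m ^ 2) × Fin (m ^ 2) → Fin (m ^ 2)) :
    ((∀ v : Fin (m ^ 2), ∀ r : Fin (m ^ 2), ∃! c : Fin (m ^ 2), f (r, c) = v) ∧
     (∀ v : Fin (m ^ 2), ∀ c : Fin (m ^ 2), ∃! r : Fin (m ^ 2), f (r, c) = v) ∧
     (∀ v : Fin (m ^ 2), ∀ i j : Fin m, ∃! p : Fin (m ^ 2) × Fin (m ^ 2),
        p.1.val / m = i.val ∧ p.2.val / m = j.val ∧ f p = v))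
    ↔
    ((∀ v : Fin (m ^ 2), ∀ i j : Fin m, ∃! p : Fin (m ^ 2) × Fin (m ^ 2),
        p.1.val / m = i.val ∧ p.2.val / m = j.val ∧ f p = v) ∧
     (∀ p q : Fin (m ^ 2) × Fin (m ^ 2),
        p.1.val / m = q.1.val / m → p.2.val / m ≠ q.2.val / m → f p = f q → p.1 ≠ q.1) ∧
     (∀ p q : Fin (m ^ 2) × Fin (m ^ 2),
        p.2.val / m = q.2.val / m → p.1.val / m ≠ q.1.val / m → f p = f q → p.2 ≠ q.2)) := by
  constructor
  · rintro ⟨hrow, hcol, hblock⟩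
    refine ⟨hblock, ?_, ?_⟩
    · rintro ⟨r, c⟩ ⟨r', c'⟩ - hne hf (rfl : r = r')
      exact hne (congrArg (fun x : Fin (m ^ 2) => x.val / m) ((hrow _ r).unique hf rfl))
    · rintro ⟨r, c⟩ ⟨r', c'⟩ - hne hf (rfl : c = c')
      exact hne (congrArg (fun x : Fin (m ^ 2) => x.val / m) ((hcol _ c).unique hf rfl))
  · rintro ⟨hblock, hband, hstack⟩
    have hdiv (x : Fin (m ^ 2)) : x.val / m < m :=
      Nat.div_lt_of_lt_mul (by simpa [sq] using x.isLt)
    have block_inj (p q : Fin (m ^ 2) × Fin (m ^ 2)) (h₁ : p.1.val / m = q.1.val / m)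
        (h₂ : p.2.val / m = q.2.val / m) (hf : f p = f q) : p = q :=
      (hblock (f q) ⟨_, hdiv q.1⟩ ⟨_, hdiv q.2⟩).unique ⟨h₁, h₂, hf⟩ ⟨rfl, rfl, rfl⟩
    have row_inj (r : Fin (m ^ 2)) : Function.Injective fun c => f (r, c) := by
      intro c c' hf
      by_cases h : c.val / m = c'.val / m
      · exact congrArg Prod.snd (block_inj (r, c) (r, c') rfl h hf)
      · exact absurd rfl (hband (r, c) (r, c') rfl h hf)
    have col_inj (c : Fin (m ^ 2)) : Function.Injective fun r => f (r, c) := by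
      intro r r' hf
      by_cases h : r.val / m = r'.val / m
      · exact congrArg Prod.fst (block_inj (r, c) (r', c) h rfl hf)
      · exact absurd rfl (hstack (r, c) (r', c) rfl h hf)
    exact ⟨fun v r => (Finite.injective_iff_bijective.mp (row_inj r)).existsUnique v,
      fun v c => (Finite.injective_iff_bijective.mp (col_inj c)).existsUnique v, hblock⟩
end

section
/- Let m be a positive integer and n = m², and let f : Fin n × Fin n → Fin n. Suppose that every value v ∈ Fin n appears exactly once in each block, and that whenever two cells lying in different blocks of the same band carry the same value under f, they lie in different rows. Then every value v ∈ Fin n appears exactly once in each row. -/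
/-- If every value appears exactly once in each block, and any two cells in
different blocks of the same band carrying the same value lie in different rows, then
every value appears exactly once in each row. -/
theorem rows_of_blocks_and_bands (m : ℕ) (hm : 0 < m)
    (f : Fin (m ^ 2) × Fin (m ^ 2) → Fin (m ^ 2))
    (hblock : ∀ v : Fin (m ^ 2), ∀ i j : Fin m, ∃! p : Fin (m ^ 2) × Fin (m ^ 2),
      p.1.val / m = i.val ∧ p.2.val / m = j.val ∧ f p = v)
    (hband : ∀ p q : Fin (m ^ 2) × Fin (m ^ 2),
      p.1.val / m = q.1.val / m → p.2.val / m ≠ q.2.val / m → f p = f q → p.1 ≠ q.1) :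
    ∀ v : Fin (m ^ 2), ∀ r : Fin (m ^ 2), ∃! c : Fin (m ^ 2), f (r, c) = v := by
  intro v r
  have hdiv (x : Fin (m ^ 2)) : x.val / m < m :=
    Nat.div_lt_of_lt_mul (by simpa [sq] using x.isLt)
  have hinj : Function.Injective fun c => f (r, c) := by
    intro c d hcd
    have hcol : c.val / m = d.val / m := by
      by_contra h
      exact hband (r, c) (r, d) rfl h hcd rfl
    have heq : (r, c) = (r, d) :=
      (hblock (f (r, d)) ⟨_, hdiv r⟩ ⟨_, hdiv d⟩).unique ⟨rfl, hcol, hcd⟩ ⟨rfl, rfl, rfl⟩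
    exact congrArg Prod.snd heq
  exact (Finite.injective_iff_bijective.mp hinj).existsUnique v
end

section
/- Let m be a positive integer and n = m², and let f : Fin n × Fin n → Fin n. Suppose that every value v ∈ Fin n appears exactly once in each block, and that whenever two cells lying in different blocks of the same stack carry the same value under f, they lie in different columns. Then every value v ∈ Fin n appears exactly once in each column. -/
/-- If every value appears exactly once in each block, and any two cells in
different blocks of the same stack carrying the same value lie in different columns, then
every value appears exactly once in each column. -/
theorem cols_of_blocks_and_stacks (m : ℕ) (hm : 0 < m)
    (f : Fin (m ^ 2) × Fin (m ^ 2) → Fin (m ^ 2))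
    (hblock : ∀ v : Fin (m ^ 2), ∀ i j : Fin m, ∃! p : Fin (m ^ 2) × Fin (m ^ 2),
      p.1.val / m = i.val ∧ p.2.val / m = j.val ∧ f p = v)
    (hstack : ∀ p q : Fin (m ^ 2) × Fin (m ^ 2),
      p.2.val / m = q.2.val / m → p.1.val / m ≠ q.1.val / m → f p = f q → p.2 ≠ q.2) :
    ∀ v : Fin (m ^ 2), ∀ c : Fin (m ^ 2), ∃! r : Fin (m ^ 2), f (r, c) = v := by
  intro v c
  have div_lt (x : Fin (m ^ 2)) : x.val / m < m :=
    (Nat.div_lt_iff_lt_mul hm).2 (by simpa [sq] using x.isLt)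
  have hinj : Function.Injective fun r => f (r, c) := by
    intro r s hrs
    by_cases hb : r.val / m = s.val / m
    · have h := (hblock (f (s, c)) ⟨_, div_lt s⟩ ⟨_, div_lt c⟩).unique
        (y₁ := (r, c)) (y₂ := (s, c)) ⟨hb, rfl, hrs⟩ ⟨rfl, rfl, rfl⟩
      exact congrArg Prod.fst h
    · exact absurd rfl (hstack (r, c) (s, c) rfl hb hrs)
  exact (Finite.injective_iff_bijective.1 hinj).existsUnique v
end

section
/- Let m be a positive integer and n = m², and let f : Fin n × Fin n → Fin n. If f is not a Sudoku solution, then at least one of the following holds: some block contains two distinct cells carrying the same value under f; or two cells lying in different blocks of the same band carry the same value and lie in the same row; or two cells lying in different blocks of the same stack carry the same value and lie in the same column. -/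
/-- The `a`-th row of the `i`-th band (equivalently, the `a`-th column of the `i`-th stack). -/
def bandIndex {m : ℕ} (i a : Fin m) : Fin (m ^ 2) :=
  Fin.cast (sq m).symm (finProdFinEquiv (i, a))

theorem bandIndex_div {m : ℕ} (i a : Fin m) : (bandIndex i a).val / m = i.val := by
  simp [bandIndex, Nat.add_mul_div_left _ _ i.pos]

theorem bandIndex_injective {m : ℕ} (i : Fin m) : Function.Injective (bandIndex i) := by
  intro a b h
  simpa [bandIndex] using h

/-- A board without repeated values inside any block takes every value exactly once in each
block. -/
theorem existsUnique_mem_block {m : ℕ} (f : Fin (m ^ 2) × Fin (m ^ 2) → Fin (m ^ 2))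
    (hf : ∀ p q : Fin (m ^ 2) × Fin (m ^ 2), p.1.val / m = q.1.val / m →
      p.2.val / m = q.2.val / m → f p = f q → p = q)
    (v : Fin (m ^ 2)) (i j : Fin m) :
    ∃! p : Fin (m ^ 2) × Fin (m ^ 2), p.1.val / m = i.val ∧ p.2.val / m = j.val ∧ f p = v := by
  have hinj : Function.Injective
      fun x : Fin m × Fin m => f (bandIndex i x.1, bandIndex j x.2) := by
    rintro ⟨a, b⟩ ⟨c, d⟩ h
    have hpq := hf _ _ (by simp only [bandIndex_div]) (by simp only [bandIndex_div]) h
    rw [Prod.mk.injEq] at hpq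
    exact Prod.ext (bandIndex_injective i hpq.1) (bandIndex_injective j hpq.2)
  have hbij := (Fintype.bijective_iff_injective_and_card _).2 ⟨hinj, by simp [sq]⟩
  obtain ⟨x, hx⟩ := hbij.2 v
  refine ⟨_, ⟨bandIndex_div i x.1, bandIndex_div j x.2, hx⟩, ?_⟩
  rintro p ⟨hi, hj, hv⟩
  exact hf _ _ (hi.trans (bandIndex_div i x.1).symm) (hj.trans (bandIndex_div j x.2).symm)
    (hv.trans hx.symm)

/-- If `f` is not a Sudoku solution, then some block contains two distinct cells
with the same value, or two cells in different blocks of the same band have the same value and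
lie in the same row, or two cells in different blocks of the same stack have the same value and
lie in the same column. -/
theorem not_sudoku_gives_violation (m : ℕ) (hm : 0 < m)
    (f : Fin (m ^ 2) × Fin (m ^ 2) → Fin (m ^ 2))
    (hnot : ¬ ((∀ v : Fin (m ^ 2), ∀ r : Fin (m ^ 2), ∃! c : Fin (m ^ 2), f (r, c) = v) ∧
        (∀ v : Fin (m ^ 2), ∀ c : Fin (m ^ 2), ∃! r : Fin (m ^ 2), f (r, c) = v) ∧
        (∀ v : Fin (m ^ 2), ∀ i j : Fin m, ∃! p : Fin (m ^ 2) × Fin (m ^ 2),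
          p.1.val / m = i.val ∧ p.2.val / m = j.val ∧ f p = v))) :
    (∃ p q : Fin (m ^ 2) × Fin (m ^ 2), p ≠ q ∧
        p.1.val / m = q.1.val / m ∧ p.2.val / m = q.2.val / m ∧ f p = f q) ∨
    (∃ p q : Fin (m ^ 2) × Fin (m ^ 2),
        p.1.val / m = q.1.val / m ∧ p.2.val / m ≠ q.2.val / m ∧ f p = f q ∧ p.1 = q.1) ∨
    (∃ p q : Fin (m ^ 2) × Fin (m ^ 2),
        p.2.val / m = q.2.val / m ∧ p.1.val / m ≠ q.1.val / m ∧ f p = f q ∧ p.2 = q.2) := by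
  contrapose! hnot
  obtain ⟨hblock, hband, hstack⟩ := hnot
  have hblock' : ∀ p q : Fin (m ^ 2) × Fin (m ^ 2), p.1.val / m = q.1.val / m →
      p.2.val / m = q.2.val / m → f p = f q → p = q := fun p q h₁ h₂ h =>
    by_contra fun hne => hblock p q hne h₁ h₂ h
  refine ⟨fun v r => ?_, fun v c => ?_, existsUnique_mem_block f hblock'⟩
  · have hinj : Function.Injective fun c => f (r, c) := by
      intro c d h
      by_cases hcd : c.val / m = d.val / m
      · exact congrArg Prod.snd (hblock' (r, c) (r, d) rfl hcd h)
      · exact absurd rfl (hband (r, c) (r, d) rfl hcd h)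
    exact (Finite.injective_iff_bijective.1 hinj).existsUnique v
  · have hinj : Function.Injective fun r => f (r, c) := by
      intro r s h
      by_cases hrs : r.val / m = s.val / m
      · exact congrArg Prod.fst (hblock' (r, c) (s, c) hrs rfl h)
      · exact absurd rfl (hstack (r, c) (s, c) rfl hrs h)
    exact (Finite.injective_iff_bijective.1 hinj).existsUnique v
end
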